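/- Let d be a prime. The sign of the cyclic-shift permutation ρ of (Fin d → ZMod d), defined by (ρ f)(i) = f(i − 1) with cyclic indices, equals (−1)^((d−1)(d^(d−1) − 1)); in particular the sign is +1 when d is odd and −1 when d = 2. -/

import Mathlib

/-- The cyclic-shift permutation of the basis labels `Fin d → ZMod d` of a register of
`d` qudits of dimension `d`: it sends `f` to `i ↦ f (i - 1)`, indices taken cyclically. -/
def cyclicShift (d : ℕ) [NeZero d] : Equiv.Perm (Fin d → ZMod d) where
  toFun f := fun i => f (i - 1)
  invFun f := fun i => f (i + 1)
  left_inv f := by funext i; simp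
  right_inv f := by funext i; simp

theorem cyclicShift_pow_apply (d : ℕ) [NeZero d] (n : ℕ) (f : Fin d → ZMod d) (i : Fin d) :
    (cyclicShift d ^ n) f i = f (i - n • (1 : Fin d)) := by
  induction n generalizing i with
  | zero => simp
  | succ n ih =>
    rw [pow_succ', Equiv.Perm.mul_apply]
    change (cyclicShift d ^ n) f (i - 1) = _
    rw [ih, succ_nsmul', sub_sub]

theorem cyclicShift_pow_self (d : ℕ) [NeZero d] : cyclicShift d ^ d = 1 := by
  ext f i
  have h : d • (1 : Fin d) = 0 := by simpa using card_nsmul_eq_zero' (x := (1 : Fin d))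
  rw [cyclicShift_pow_apply, h, sub_zero, Equiv.Perm.one_apply]

/-- A permutation with a trivial odd power is even. -/
theorem Equiv.Perm.sign_eq_one_of_odd_pow_eq_one {α : Type*} [DecidableEq α] [Fintype α]
    {σ : Equiv.Perm α} {n : ℕ} (hn : Odd n) (hσ : σ ^ n = 1) : Equiv.Perm.sign σ = 1 := by
  have h := congrArg Equiv.Perm.sign hσ
  rcases Int.units_eq_one_or (Equiv.Perm.sign σ) with h1 | h1
  · exact h1
  · rw [map_pow, h1, hn.neg_one_pow, map_one] at h
    exact absurd h (by decide)

theorem sign_cyclicShift_two : Equiv.Perm.sign (cyclicShift 2) = -1 := by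
  decide

theorem sign_cyclicShift (d : ℕ) [Fact d.Prime] :
    Equiv.Perm.sign (cyclicShift d) = (-1) ^ ((d - 1) * (d ^ (d - 1) - 1)) ∧
    (Odd d → Equiv.Perm.sign (cyclicShift d) = 1) ∧
    (d = 2 → Equiv.Perm.sign (cyclicShift d) = -1) := by
  have h_odd (h : Odd d) : Equiv.Perm.sign (cyclicShift d) = 1 :=
    Equiv.Perm.sign_eq_one_of_odd_pow_eq_one h (cyclicShift_pow_self d)
  have h_two (h : d = 2) : Equiv.Perm.sign (cyclicShift d) = -1 := by
    subst h
    exact sign_cyclicShift_two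
  refine ⟨?_, h_odd, h_two⟩
  rcases (Fact.out : d.Prime).eq_two_or_odd' with h | h
  · rw [h_two h]
    simp [h]
  · rw [h_odd h, ((Nat.Odd.sub_odd h odd_one).mul_right _).neg_one_pow]
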